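/- Let b be an inner function, i.e. b is in the closed unit ball H∞₁ of the bounded holomorphic functions on the open unit disk 𝔻 and the radial boundary values of b have modulus 1 at almost every point of the unit circle. If b is nonconstant and H(b) has the complete Nevanlinna–Pick property, then b is a disk automorphism, i.e. b(z) = λ·(z − c)/(1 − conj(c)·z) for some unimodular constant λ and some c ∈ 𝔻; in particular the model space H² ⊖ bH² is one-dimensional. -/

import Mathlib

open Complex Set Filter MeasureTheory

noncomputable section

/-- The open unit disk in `ℂ`. -/
def unitDisk : Set ℂ := Metric.ball 0 1

/-- `K` is a positive kernel on the unit disk: it is Hermitian symmetric and all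
finite Gram-type sums are (real and) nonnegative. -/
def IsPosKernel (K : ℂ → ℂ → ℂ) : Prop :=
  (∀ z ∈ unitDisk, ∀ w ∈ unitDisk, K z w = starRingEnd ℂ (K w z)) ∧
  ∀ (n : ℕ) (lam : Fin n → ℂ), (∀ i, lam i ∈ unitDisk) →
    ∀ c : Fin n → ℂ,
      0 ≤ (∑ i, ∑ j, c i * starRingEnd ℂ (c j) * K (lam i) (lam j)).re

/-- `b` belongs to the closed unit ball `H∞₁` of bounded holomorphic functions on
the unit disk. -/
def MemBallHinf (b : ℂ → ℂ) : Prop :=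
  DifferentiableOn ℂ b unitDisk ∧ ∀ z ∈ unitDisk, ‖b z‖ ≤ 1

/-- `b` is nonconstant on the unit disk. -/
def NonconstOnDisk (b : ℂ → ℂ) : Prop :=
  ∃ z ∈ unitDisk, ∃ w ∈ unitDisk, b z ≠ b w

/-- The de Branges–Rovnyak kernel `k^b(z,w) = (1 - conj (b w) * b z) / (1 - conj w * z)`. -/
def dbrKernel (b : ℂ → ℂ) (z w : ℂ) : ℂ :=
  (1 - starRingEnd ℂ (b w) * b z) / (1 - starRingEnd ℂ w * z)

/-- The de Branges–Rovnyak space `H(b)` has the complete Nevanlinna–Pick property: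
`k^b` never vanishes on `𝔻 × 𝔻` and
`(z,w) ↦ 1 - k^b(z,0) k^b(0,w) / (k^b(0,0) k^b(z,w))` is a positive kernel. -/
def HasCNP (b : ℂ → ℂ) : Prop :=
  (∀ z ∈ unitDisk, ∀ w ∈ unitDisk, dbrKernel b z w ≠ 0) ∧
  IsPosKernel (fun z w =>
    1 - dbrKernel b z 0 * dbrKernel b 0 w / (dbrKernel b 0 0 * dbrKernel b z w))

/-- `f` belongs to the Hardy space `H²` with Taylor coefficient sequence `a`:
`f z = ∑ₙ a n * zⁿ` on the unit disk and `∑ₙ ‖a n‖² < ∞`. -/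
def MemH2 (f : ℂ → ℂ) (a : ℕ → ℂ) : Prop :=
  (∀ z ∈ unitDisk, HasSum (fun n => a n * z ^ n) (f z)) ∧
  Summable (fun n => ‖a n‖ ^ 2)

/-- `b` is an inner function: it lies in the closed unit ball of `H^∞` and its
radial limits have modulus `1` at almost every point of the unit circle. -/
def IsInner (b : ℂ → ℂ) : Prop :=
  MemBallHinf b ∧
  ∀ᵐ (θ : ℝ) ∂(volume.restrict (Set.Ioc (0 : ℝ) (2 * Real.pi))),
    ∃ L : ℂ, ‖L‖ = 1 ∧
      Tendsto (fun r : ℝ => b ((r : ℂ) * Complex.exp ((θ : ℂ) * Complex.I)))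
        (nhdsWithin 1 (Set.Iio 1)) (nhds L)

/-- `f` (with coefficient sequence `fa`) lies in the model space `H² ⊖ bH²`:
it is in `H²` and is orthogonal to every `H²` function of the form `b * g` with
`g ∈ H²`. -/
def MemModelSpace (b f : ℂ → ℂ) (fa : ℕ → ℂ) : Prop :=
  MemH2 f fa ∧
  ∀ (p : ℂ → ℂ) (pa : ℕ → ℂ) (g : ℂ → ℂ) (ga : ℕ → ℂ),
    MemH2 p pa → MemH2 g ga → (∀ z ∈ unitDisk, p z = b z * g z) →
    ∑' n, fa n * starRingEnd ℂ (pa n) = 0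

open scoped Topology ComplexConjugate

/-- Coefficients of the polynomial `(α + β z) zⁿ`. -/
def twoTermCoeff (n : ℕ) (α β : ℂ) (k : ℕ) : ℂ :=
  if k = n then α else if k = n + 1 then β else 0

theorem hasSum_mul_two_term (n : ℕ) (α β : ℂ) (F : ℕ → ℂ → ℂ) (hF : ∀ k, F k 0 = 0) :
    HasSum (fun k => F k (twoTermCoeff n α β k)) (F n α + F (n + 1) β) := by
  have h := hasSum_sum_of_ne_finset_zero (f := fun k => F k (twoTermCoeff n α β k))
    (s := {n, n + 1}) (L := SummationFilter.unconditional ℕ) (by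
      intro k hk
      simp only [Finset.mem_insert, Finset.mem_singleton, not_or] at hk
      simp [twoTermCoeff, hk.1, hk.2, hF])
  rw [Finset.sum_pair (by simp)] at h
  simpa [twoTermCoeff] using h

theorem memH2_two_term (n : ℕ) (α β : ℂ) :
    MemH2 (fun z => (α + β * z) * z ^ n) (twoTermCoeff n α β) := by
  refine ⟨fun z _ => ?_, ?_⟩
  · have h := hasSum_mul_two_term n α β (fun k a => a * z ^ k) (by simp)
    convert h using 1
    ring
  · refine summable_of_ne_finset_zero (s := {n, n + 1}) ?_
    intro k hk
    simp only [Finset.mem_insert, Finset.mem_singleton, not_or] at hk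
    simp [twoTermCoeff, hk.1, hk.2]

theorem one_sub_conj_mul_ne_zero {c z : ℂ} (hc : ‖c‖ ≤ 1) (hz : ‖z‖ < 1) :
    1 - conj c * z ≠ 0 := by
  intro h
  have h1 : ‖conj c * z‖ = 1 := by rw [← sub_eq_zero.1 h]; simp
  rw [norm_mul, Complex.norm_conj] at h1
  nlinarith [norm_nonneg c, norm_nonneg z]

/-- The model space of a disk automorphism with zero `c` is spanned by the Szegő kernel at `c`. -/
theorem modelSpace_automorphism_one_dimensional {b : ℂ → ℂ} {lam c : ℂ} (hlam : lam ≠ 0)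
    (hc : c ∈ unitDisk)
    (hb : ∀ z ∈ unitDisk, b z = lam * (z - c) / (1 - conj c * z)) :
    ∃ (f₀ : ℂ → ℂ) (fa₀ : ℕ → ℂ), MemModelSpace b f₀ fa₀ ∧ (∃ n, fa₀ n ≠ 0) ∧
      ∀ (f : ℂ → ℂ) (fa : ℕ → ℂ), MemModelSpace b f fa →
        ∃ c : ℂ, ∀ z ∈ unitDisk, f z = c * f₀ z := by
  have hc1 : ‖c‖ < 1 := by simpa [unitDisk] using hc
  have hgeom : ∀ z ∈ unitDisk, HasSum (fun n => conj c ^ n * z ^ n) (1 - conj c * z)⁻¹ := by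
    intro z hz
    have hz1 : ‖z‖ < 1 := by simpa [unitDisk] using hz
    simp only [← mul_pow]
    apply hasSum_geometric_of_norm_lt_one
    rw [norm_mul, Complex.norm_conj]
    nlinarith [norm_nonneg c, norm_nonneg z]
  refine ⟨fun z => (1 - conj c * z)⁻¹, fun n => conj c ^ n, ⟨⟨hgeom, ?_⟩, ?_⟩, ⟨0, by simp⟩, ?_⟩
  · have h : ∀ n : ℕ, ‖conj c ^ n‖ ^ 2 = (‖c‖ ^ 2) ^ n := fun n => by
      rw [norm_pow, Complex.norm_conj, ← pow_mul, ← pow_mul, mul_comm]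
    simp only [h]
    exact summable_geometric_of_lt_one (by positivity) (by nlinarith [norm_nonneg c])
  · intro p pa g ga hp _ hpg
    have hpc : p c = 0 := by rw [hpg c hc, hb c hc]; simp
    have h := Complex.hasSum_conj'.2 (hp.1 c hc)
    rw [hpc, map_zero] at h
    convert h.tsum_eq using 3 with n
    simp [mul_comm]
  · intro f fa hf
    have hrec : ∀ n, fa (n + 1) = conj c * fa n := by
      intro n
      have h := hf.2 _ _ _ _ (memH2_two_term n (lam * -c) lam) (memH2_two_term n 1 (-conj c)) (by
        intro z hz
        have hz1 : ‖z‖ < 1 := by simpa [unitDisk] using hz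
        have := one_sub_conj_mul_ne_zero hc1.le hz1
        rw [hb z hz, div_mul_eq_mul_div, eq_div_iff this]
        ring)
      rw [(hasSum_mul_two_term n (lam * -c) lam (fun k a => fa k * conj a) (by simp)).tsum_eq] at h
      have hl : conj lam ≠ 0 := by simpa using hlam
      apply mul_left_cancel₀ hl
      simp only [map_mul, map_neg] at h
      linear_combination h
    have hfa : ∀ n, fa n = fa 0 * conj c ^ n := by
      intro n
      induction n with
      | zero => simp
      | succ n ih => rw [hrec, ih]; ring
    refine ⟨fa 0, fun z hz => (hf.1.1 z hz).unique ?_⟩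
    have h := (hgeom z hz).mul_left (fa 0)
    simp only [← mul_assoc, ← hfa] at h
    exact h

/-- A bounded holomorphic function whose radial limits have modulus one almost everywhere
is bounded by one at the origin. -/
theorem norm_zero_le_one_of_radial_limits {f : ℂ → ℂ} {M : ℝ}
    (hf : DifferentiableOn ℂ f unitDisk) (hM : ∀ z ∈ unitDisk, ‖f z‖ ≤ M)
    (hlim : ∀ᵐ (θ : ℝ) ∂(volume.restrict (Set.Ioc (0 : ℝ) (2 * Real.pi))),
      Tendsto (fun r : ℝ => ‖f ((r : ℂ) * Complex.exp ((θ : ℂ) * Complex.I))‖)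
        (𝓝[<] 1) (𝓝 1)) :
    ‖f 0‖ ≤ 1 := by
  have hpi := Real.two_pi_pos
  have hr : ∀ᶠ r : ℝ in 𝓝[<] 1, r ∈ Set.Ioo (0 : ℝ) 1 := Ioo_mem_nhdsLT one_pos
  have hmem : ∀ r ∈ Set.Ioo (0 : ℝ) 1, ∀ θ : ℝ,
      (r : ℂ) * Complex.exp ((θ : ℂ) * Complex.I) ∈ unitDisk := by
    intro r hr θ
    simp [unitDisk, Complex.norm_exp_ofReal_mul_I, abs_of_pos hr.1, hr.2]
  have hcont : ∀ r ∈ Set.Ioo (0 : ℝ) 1,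
      Continuous (fun θ : ℝ => f ((r : ℂ) * Complex.exp ((θ : ℂ) * Complex.I))) := fun r hr =>
    hf.continuousOn.comp_continuous (by fun_prop) (hmem r hr)
  have hT : Tendsto (fun r : ℝ => ∫ θ in (0 : ℝ)..2 * Real.pi,
      ‖f ((r : ℂ) * Complex.exp ((θ : ℂ) * Complex.I))‖) (𝓝[<] 1)
      (𝓝 (∫ _ in (0 : ℝ)..2 * Real.pi, (1 : ℝ))) := by
    refine intervalIntegral.tendsto_integral_filter_of_dominated_convergence (fun _ => M) ?_ ?_
      (by simp) ?_
    · filter_upwards [hr] with r hr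
      exact (hcont r hr).norm.aestronglyMeasurable
    · filter_upwards [hr] with r hr
      refine ae_of_all _ fun θ _ => ?_
      rw [norm_norm]
      exact hM _ (hmem r hr θ)
    · rw [Set.uIoc_of_le hpi.le]
      exact (ae_restrict_iff' measurableSet_Ioc).1 hlim
  have hmean : ∀ᶠ r : ℝ in 𝓝[<] 1, 2 * Real.pi * ‖f 0‖ ≤ ∫ θ in (0 : ℝ)..2 * Real.pi,
      ‖f ((r : ℂ) * Complex.exp ((θ : ℂ) * Complex.I))‖ := by
    filter_upwards [hr] with r hr
    have hd : DiffContOnCl ℂ f (Metric.ball 0 |r|) := by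
      apply DifferentiableOn.diffContOnCl
      refine hf.mono fun z hz => ?_
      have := Metric.closure_ball_subset_closedBall hz
      rw [abs_of_pos hr.1] at this
      simp only [unitDisk, Metric.mem_ball, Metric.mem_closedBall] at *
      linarith [hr.2]
    have h := hd.circleAverage
    rw [Real.circleAverage_def] at h
    simp only [circleMap, zero_add] at h
    rw [← h, norm_smul, Real.norm_of_nonneg (by positivity), ← mul_assoc,
      mul_inv_cancel₀ hpi.ne', one_mul]
    exact intervalIntegral.norm_integral_le_integral_norm hpi.le
  have h := ge_of_tendsto hT hmean
  simp only [intervalIntegral.integral_const, smul_eq_mul, sub_zero, mul_one] at h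
  nlinarith

/-- Cauchy–Schwarz inequality for positive kernels. -/
theorem IsPosKernel.normSq_le {K : ℂ → ℂ → ℂ} (hK : IsPosKernel K) {z w : ℂ}
    (hz : z ∈ unitDisk) (hw : w ∈ unitDisk) :
    Complex.normSq (K z w) ≤ (K z z).re * (K w w).re := by
  have hzw := hK.1 w hw z hz
  have hzz : (K z z).im = 0 := Complex.conj_eq_iff_im.1 (hK.1 z hz z hz).symm
  have hww : (K w w).im = 0 := Complex.conj_eq_iff_im.1 (hK.1 w hw w hw).symm
  have key : ∀ a d : ℂ, 0 ≤ Complex.normSq a * (K z z).re + 2 * (a * conj d * K z w).re +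
      Complex.normSq d * (K w w).re := by
    intro a d
    have h := hK.2 2 ![z, w] (by intro i; fin_cases i <;> simpa) ![a, d]
    simp only [Fin.sum_univ_two, Matrix.cons_val_zero, Matrix.cons_val_one, hzw] at h
    convert h using 1
    simp [Complex.normSq_apply, hzz, hww]
    ring
  set B := K z w
  have hA : 0 ≤ (K z z).re := by simpa using key 1 0
  have hC : 0 ≤ (K w w).re := by simpa using key 0 1
  have hquad : ∀ x : ℝ, 0 ≤ (Complex.normSq B * (K z z).re) * (x * x) +
      (2 * Complex.normSq B) * x + (K w w).re := by
    intro x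
    have h := key (x * conj B) 1
    convert h using 1
    simp [Complex.normSq_apply]
    ring
  have hdisc := discrim_le_zero hquad
  rw [discrim] at hdisc
  rcases (Complex.normSq_nonneg B).eq_or_lt with h0 | h0
  · rw [← h0]; positivity
  · by_contra! hlt
    nlinarith

theorem one_sub_normSq_mul_le {u v : ℂ} :
    (1 - Complex.normSq u) * (1 - Complex.normSq v) =
      Complex.normSq (1 - u * conj v) - Complex.normSq (u - v) := by
  simp [Complex.normSq_apply]
  ring

/-- The disk automorphism sending `β` to `0`, composed with `b`. -/
def moebiusComp (β : ℂ) (b : ℂ → ℂ) (z : ℂ) : ℂ := (b z - β) / (1 - conj β * b z)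

theorem norm_moebius_eq_one {β L : ℂ} (hβ : ‖β‖ < 1) (hL : ‖L‖ = 1) :
    ‖(L - β) / (1 - conj β * L)‖ = 1 := by
  have h := @one_sub_normSq_mul_le L β
  rw [Complex.normSq_eq_norm_sq L, hL] at h
  have h2 : Complex.normSq (L - β) = Complex.normSq (1 - conj β * L) := by
    rw [mul_comm (conj β)]; linarith
  have hne : 1 - conj β * L ≠ 0 := by
    intro h0
    have h1 : ‖conj β * L‖ = 1 := by rw [← sub_eq_zero.1 h0]; simp
    rw [norm_mul, Complex.norm_conj, hL] at h1
    linarith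
  rw [Complex.normSq_eq_norm_sq, Complex.normSq_eq_norm_sq,
    sq_eq_sq₀ (norm_nonneg _) (norm_nonneg _)] at h2
  rw [norm_div, h2, div_self (norm_ne_zero_iff.2 hne)]

theorem norm_moebius_lt_one {β L : ℂ} (hβ : ‖β‖ < 1) (hL : ‖L‖ < 1) :
    ‖(L - β) / (1 - conj β * L)‖ < 1 := by
  have h := @one_sub_normSq_mul_le L β
  have hne := one_sub_conj_mul_ne_zero hβ.le hL
  rw [norm_div, div_lt_one (norm_pos_iff.2 hne)]
  simp only [Complex.normSq_eq_norm_sq] at h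
  have h1 : 0 < (1 - ‖L‖ ^ 2) * (1 - ‖β‖ ^ 2) := by
    apply mul_pos <;> nlinarith [norm_nonneg L, norm_nonneg β]
  rw [mul_comm (conj β)]
  refine lt_of_pow_lt_pow_left₀ 2 (norm_nonneg _) (by linarith)

/-- In terms of the normalized function `φ`, the Nevanlinna–Pick kernel is
`(z w̄ - φ(z) conj φ(w)) / (1 - φ(z) conj φ(w))`. -/
theorem cnp_kernel_eq {b : ℂ → ℂ} (hb : ∀ z ∈ unitDisk, ‖b z‖ < 1) {z w : ℂ}
    (hz : z ∈ unitDisk) (hw : w ∈ unitDisk) :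
    1 - dbrKernel b z 0 * dbrKernel b 0 w / (dbrKernel b 0 0 * dbrKernel b z w) =
      (z * conj w - moebiusComp (b 0) b z * conj (moebiusComp (b 0) b w)) /
        (1 - moebiusComp (b 0) b z * conj (moebiusComp (b 0) b w)) := by
  have h0 : (0 : ℂ) ∈ unitDisk := by simp [unitDisk]
  have hz1 : ‖z‖ < 1 := by simpa [unitDisk] using hz
  have hw1 : ‖w‖ < 1 := by simpa [unitDisk] using hw
  have e1 := one_sub_conj_mul_ne_zero (hb 0 h0).le (hb z hz)
  have e2 := one_sub_conj_mul_ne_zero (hb w hw).le (hb 0 h0)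
  have e3 := one_sub_conj_mul_ne_zero (hb 0 h0).le (hb 0 h0)
  have e4 := one_sub_conj_mul_ne_zero (hb w hw).le (hb z hz)
  have e5 := one_sub_conj_mul_ne_zero hw1.le hz1
  have e6 := one_sub_conj_mul_ne_zero (norm_moebius_lt_one (hb 0 h0) (hb w hw)).le
    (norm_moebius_lt_one (hb 0 h0) (hb z hz))
  have e2' : 1 - b 0 * conj (b w) ≠ 0 := by rwa [mul_comm]
  have e4' : 1 - b z * conj (b w) ≠ 0 := by rwa [mul_comm]
  have e7 : 1 - moebiusComp (b 0) b z * conj (moebiusComp (b 0) b w) ≠ 0 := by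
    rw [mul_comm]; exact e6
  rw [eq_div_iff e7]
  simp only [moebiusComp, dbrKernel, map_div₀, map_sub, map_mul, map_one, Complex.conj_conj,
    map_zero, zero_mul, mul_zero, sub_zero, div_one]
  field_simp
  ring

/-- The invariant form of the Schwarz–Pick type inequality obtained from positivity of
`(1 - ψ(z) conj ψ(w)) / (1 - φ(z) conj φ(w))`, where `φ(z) = z ψ(z)`. -/
theorem schwarzPick_of_kernel_pos {φ ψ : ℂ → ℂ} (hφψ : ∀ z, φ z = z * ψ z)
    (hφ : ∀ z ∈ unitDisk, ‖φ z‖ < 1) (hψ : ContinuousAt ψ 0)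
    (hpos : IsPosKernel fun z w => (z * conj w - φ z * conj (φ w)) / (1 - φ z * conj (φ w)))
    {z : ℂ} (hz : z ∈ unitDisk) :
    Complex.normSq (ψ z - ψ 0) ≤
      Complex.normSq (φ z) * Complex.normSq (1 - ψ z * conj (ψ 0)) := by
  rcases eq_or_ne z 0 with rfl | hz0
  · simp [hφψ]
  have hφ0 : φ 0 = 0 := by simp [hφψ]
  have hone : ∀ u ∈ unitDisk, 0 < 1 - Complex.normSq (φ u) := by
    intro u hu
    rw [Complex.normSq_eq_norm_sq]
    nlinarith [hφ u hu, norm_nonneg (φ u)]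
  have hdiag : ∀ u ∈ unitDisk, ((u * conj u - φ u * conj (φ u)) / (1 - φ u * conj (φ u))).re =
      Complex.normSq u * (1 - Complex.normSq (ψ u)) / (1 - Complex.normSq (φ u)) := by
    intro u _
    rw [Complex.mul_conj, Complex.mul_conj, hφψ u, map_mul]
    norm_cast
    ring
  have hineq : ∀ w ∈ unitDisk, w ≠ 0 →
      Complex.normSq (1 - ψ z * conj (ψ w)) *
          ((1 - Complex.normSq (φ z)) * (1 - Complex.normSq (φ w))) ≤
        (1 - Complex.normSq (ψ z)) * (1 - Complex.normSq (ψ w)) *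
          Complex.normSq (1 - φ z * conj (φ w)) := by
    intro w hw hw0
    have h := hpos.normSq_le hz hw
    simp only [hdiag z hz, hdiag w hw] at h
    have hnum : z * conj w - φ z * conj (φ w) = z * conj w * (1 - ψ z * conj (ψ w)) := by
      rw [hφψ z, hφψ w, map_mul]; ring
    have hden : 0 < Complex.normSq (1 - φ z * conj (φ w)) := by
      rw [Complex.normSq_pos, mul_comm]
      exact one_sub_conj_mul_ne_zero (hφ w hw).le (hφ z hz)
    have hzp := Complex.normSq_pos.2 hz0
    have hwp := Complex.normSq_pos.2 hw0
    rw [hnum, map_div₀, map_mul, map_mul, Complex.normSq_conj, div_mul_div_comm,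
      div_le_div_iff₀ hden (mul_pos (hone z hz) (hone w hw))] at h
    refine le_of_mul_le_mul_left ?_ (mul_pos hzp hwp)
    linarith
  have hφc : ContinuousAt φ 0 := by
    rw [show φ = fun z => z * ψ z from funext hφψ]
    exact continuousAt_id.mul hψ
  have hev : ∀ᶠ w in 𝓝[≠] (0 : ℂ), w ∈ unitDisk ∧ w ≠ 0 :=
    (eventually_nhdsWithin_of_eventually_nhds (Metric.ball_mem_nhds _ one_pos)).and
      self_mem_nhdsWithin
  have hns := Complex.continuous_normSq
  have hcj := Complex.continuous_conj
  have hlim := le_of_tendsto_of_tendsto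
    (f := fun w => Complex.normSq (1 - ψ z * conj (ψ w)) *
          ((1 - Complex.normSq (φ z)) * (1 - Complex.normSq (φ w))))
    (g := fun w => (1 - Complex.normSq (ψ z)) * (1 - Complex.normSq (ψ w)) *
          Complex.normSq (1 - φ z * conj (φ w))) (b := 𝓝[≠] (0 : ℂ))
    (ContinuousAt.continuousWithinAt (by fun_prop)) (ContinuousAt.continuousWithinAt (by fun_prop))
    (hev.mono fun w hw => hineq w hw.1 hw.2)
  simp only [hφ0, map_zero, mul_zero, sub_zero, map_one, mul_one] at hlim
  rw [one_sub_normSq_mul_le] at hlim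
  linarith

/-- An inner function `φ` with `φ(0) = 0`, `φ(z) = z ψ(z)`, satisfying the Schwarz–Pick type
inequality of `ψ` against `φ` has `|ψ(0)| ≥ 1`. -/
theorem one_le_norm_of_schwarzPick {φ ψ : ℂ → ℂ} (hφψ : ∀ z, φ z = z * ψ z)
    (hψd : DifferentiableOn ℂ ψ unitDisk) (hψ1 : ∀ z ∈ unitDisk, ‖ψ z‖ ≤ 1)
    (hne : ∃ z ∈ unitDisk, φ z ≠ 0)
    (hsp : ∀ z ∈ unitDisk, Complex.normSq (ψ z - ψ 0) ≤
      Complex.normSq (φ z) * Complex.normSq (1 - ψ z * conj (ψ 0)))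
    (hlim : ∀ᵐ (θ : ℝ) ∂(volume.restrict (Set.Ioc (0 : ℝ) (2 * Real.pi))),
      Tendsto (fun r : ℝ => ‖φ ((r : ℂ) * Complex.exp ((θ : ℂ) * Complex.I))‖)
        (𝓝[<] 1) (𝓝 1)) :
    1 ≤ ‖ψ 0‖ := by
  have h0 : (0 : ℂ) ∈ unitDisk := by simp [unitDisk]
  have hsp' : ∀ z ∈ unitDisk, ‖ψ z - ψ 0‖ ≤ ‖z‖ * ‖ψ z‖ * ‖1 - ψ z * conj (ψ 0)‖ := by
    intro z hz
    have h := hsp z hz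
    simp only [Complex.normSq_eq_norm_sq] at h
    rw [← mul_pow, hφψ, norm_mul] at h
    exact le_of_sq_le_sq h (by positivity)
  have ha : ψ 0 ≠ 0 := by
    intro ha
    obtain ⟨z, hz, hφz⟩ := hne
    have h := hsp' z hz
    have hz1 : ‖z‖ < 1 := by simpa [unitDisk] using hz
    simp only [ha, map_zero, mul_zero, sub_zero, norm_one, mul_one] at h
    have : 0 < ‖ψ z‖ := norm_pos_iff.2 fun h => hφz (by rw [hφψ, h, mul_zero])
    nlinarith
  have hapos : 0 < ‖ψ 0‖ := norm_pos_iff.2 ha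
  have hlow : ∀ z ∈ unitDisk, ‖ψ 0‖ ≤ 3 * ‖ψ z‖ := by
    intro z hz
    have hz1 : ‖z‖ < 1 := by simpa [unitDisk] using hz
    have h1 : ‖1 - ψ z * conj (ψ 0)‖ ≤ 2 := by
      refine (norm_sub_le _ _).trans ?_
      rw [norm_mul, Complex.norm_conj, norm_one]
      nlinarith [hψ1 z hz, hψ1 0 h0, norm_nonneg (ψ z), norm_nonneg (ψ 0)]
    have h2 : ‖z‖ * ‖ψ z‖ ≤ ‖ψ z‖ := mul_le_of_le_one_left (norm_nonneg _) hz1.le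
    have h3 : ‖z‖ * ‖ψ z‖ * ‖1 - ψ z * conj (ψ 0)‖ ≤ ‖ψ z‖ * 2 :=
      mul_le_mul h2 h1 (norm_nonneg _) (norm_nonneg _)
    have h4 := norm_sub_norm_le (ψ 0) (ψ z)
    rw [norm_sub_rev] at h4
    linarith [hsp' z hz]
  have hψne : ∀ z ∈ unitDisk, ψ z ≠ 0 := by
    intro z hz h
    have := hlow z hz
    rw [h, norm_zero] at this
    linarith
  have hinv : ‖(ψ 0)⁻¹‖ ≤ 1 := by
    refine norm_zero_le_one_of_radial_limits (f := fun z => (ψ z)⁻¹) (M := 3 / ‖ψ 0‖)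
      (hψd.inv hψne) (fun z hz => ?_) ?_
    · rw [norm_inv, inv_eq_one_div, div_le_div_iff₀ (norm_pos_iff.2 (hψne z hz)) hapos]
      linarith [hlow z hz]
    · filter_upwards [hlim] with θ hθ
      have hr : ∀ᶠ r : ℝ in 𝓝[<] 1, r ∈ Set.Ioo (0 : ℝ) 1 := Ioo_mem_nhdsLT one_pos
      have hid : Tendsto (fun r : ℝ => r) (𝓝[<] 1) (𝓝 1) := nhdsWithin_le_nhds
      have h := hid.div hθ one_ne_zero
      rw [div_one] at h
      refine h.congr' ?_
      filter_upwards [hr] with r hr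
      simp only [Pi.div_apply]
      rw [hφψ, norm_mul, norm_mul, Complex.norm_exp_ofReal_mul_I, mul_one, Complex.norm_real,
        Real.norm_of_nonneg hr.1.le, norm_inv]
      field_simp [hr.1.ne']
  rw [norm_inv] at hinv
  exact (inv_le_one₀ hapos).1 hinv

/-- a nonconstant inner function `b` whose de Branges–Rovnyak space
has the complete Nevanlinna–Pick property is a disk automorphism
`b z = λ (z - c)/(1 - conj c * z)`; in particular the model space `H² ⊖ bH²` is
one-dimensional. -/
theorem inner_CNP_is_automorphism (b : ℂ → ℂ) (hinner : IsInner b)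
    (hnc : NonconstOnDisk b) (hcnp : HasCNP b) :
    (∃ lam c : ℂ, ‖lam‖ = 1 ∧ c ∈ unitDisk ∧
      ∀ z ∈ unitDisk, b z = lam * (z - c) / (1 - starRingEnd ℂ c * z)) ∧
    (∃ (f₀ : ℂ → ℂ) (fa₀ : ℕ → ℂ), MemModelSpace b f₀ fa₀ ∧ (∃ n, fa₀ n ≠ 0) ∧
      ∀ (f : ℂ → ℂ) (fa : ℕ → ℂ), MemModelSpace b f fa →
        ∃ c : ℂ, ∀ z ∈ unitDisk, f z = c * f₀ z) := by
  suffices h : ∃ lam c : ℂ, ‖lam‖ = 1 ∧ c ∈ unitDisk ∧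
      ∀ z ∈ unitDisk, b z = lam * (z - c) / (1 - starRingEnd ℂ c * z) by
    refine ⟨h, ?_⟩
    obtain ⟨lam, c, hlam, hc, hb⟩ := h
    exact modelSpace_automorphism_one_dimensional (norm_ne_zero_iff.1 (by simp [hlam])) hc hb
  obtain ⟨⟨hbd, hb1⟩, hblim⟩ := hinner
  have h0 : (0 : ℂ) ∈ unitDisk := by simp [unitDisk]
  have hblt : ∀ z ∈ unitDisk, ‖b z‖ < 1 := by
    intro z hz
    refine (hb1 z hz).lt_of_ne fun h => hcnp.1 z hz z hz ?_
    rw [dbrKernel, mul_comm (conj (b z)), Complex.mul_conj, Complex.normSq_eq_norm_sq, h]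
    simp
  set β := b 0 with hβ
  set φ := moebiusComp β b with hφ
  have hβ1 : ‖β‖ < 1 := hblt 0 h0
  have hden : ∀ z ∈ unitDisk, 1 - conj β * b z ≠ 0 := fun z hz =>
    one_sub_conj_mul_ne_zero hβ1.le (hblt z hz)
  have hφlt : ∀ z ∈ unitDisk, ‖φ z‖ < 1 := fun z hz => norm_moebius_lt_one hβ1 (hblt z hz)
  have hφ0 : φ 0 = 0 := by simp [hφ, moebiusComp, hβ]
  have hφd : DifferentiableOn ℂ φ unitDisk :=
    (hbd.sub_const β).div ((hbd.const_mul _).const_sub 1) hden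
  have hbφ : ∀ z ∈ unitDisk, b z * (1 + conj β * φ z) = φ z + β := by
    intro z hz
    have := hden z hz
    have h' : 1 - b z * conj β ≠ 0 := by rwa [mul_comm]
    simp only [hφ, moebiusComp]
    field_simp
    ring
  have hnhds : unitDisk ∈ 𝓝 (0 : ℂ) := Metric.ball_mem_nhds _ one_pos
  have hψd : DifferentiableOn ℂ (dslope φ 0) unitDisk :=
    (Complex.differentiableOn_dslope hnhds).2 hφd
  have hmaps : MapsTo φ (Metric.ball 0 1) (Metric.closedBall (φ 0) 1) := by
    intro z hz
    simpa [hφ0] using (hφlt z hz).le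
  have hψ1 : ∀ z ∈ unitDisk, ‖dslope φ 0 z‖ ≤ 1 := fun z hz => by
    simpa using Complex.norm_dslope_le_div_of_mapsTo_ball hφd hmaps hz
  have hφψ : ∀ z, φ z = z * dslope φ 0 z := fun z => by
    simpa using (sub_smul_dslope_of_zero hφ0 z).symm
  have hpos : IsPosKernel fun z w =>
      (z * conj w - φ z * conj (φ w)) / (1 - φ z * conj (φ w)) := by
    refine ⟨fun z hz w hw => ?_, fun n l hl c => ?_⟩
    · simp only [← cnp_kernel_eq hblt hz hw, ← cnp_kernel_eq hblt hw hz, hφ, hβ]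
      exact hcnp.2.1 z hz w hw
    · have h := hcnp.2.2 n l hl c
      simp only [cnp_kernel_eq hblt (hl _) (hl _)] at h
      exact h
  have hone : 1 ≤ ‖dslope φ 0 0‖ := by
    refine one_le_norm_of_schwarzPick hφψ hψd hψ1 ?_ (fun z hz =>
      schwarzPick_of_kernel_pos hφψ hφlt (hψd.continuousOn.continuousAt hnhds) hpos hz) ?_
    · by_contra! hzero
      obtain ⟨z, hz, w, hw, hzw⟩ := hnc
      have h1 := hbφ z hz
      have h2 := hbφ w hw
      rw [hzero z hz] at h1
      rw [hzero w hw] at h2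
      simp only [mul_zero, add_zero, mul_one] at h1 h2
      exact hzw (h1.trans h2.symm)
    · filter_upwards [hblim] with θ ⟨L, hL, hθ⟩
      have hLne : 1 - conj β * L ≠ 0 := by
        rw [← Complex.conj_conj (1 - conj β * L), map_ne_zero]
        simpa [mul_comm] using one_sub_conj_mul_ne_zero hL.le hβ1
      have h := ((hθ.sub_const β).div ((hθ.const_mul _).const_sub 1) hLne).norm
      rwa [norm_moebius_eq_one hβ1 hL] at h
  have hnorm : ‖dslope φ 0 0‖ = 1 := le_antisymm (hψ1 0 h0) hone
  obtain ⟨a, ha⟩ : ∃ a, dslope φ 0 0 = a := ⟨_, rfl⟩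
  have hlin := Complex.affine_of_mapsTo_ball_of_norm_dslope_eq_div hφd hmaps h0
    (hnorm.trans (div_one 1).symm)
  rw [ha] at hnorm hlin
  have hφlin : ∀ z ∈ unitDisk, φ z = a * z := by
    intro z hz
    simpa [hφ0, mul_comm] using hlin hz
  have haa : conj a * a = 1 := by
    rw [mul_comm, Complex.mul_conj, Complex.normSq_eq_norm_sq, hnorm]; simp
  have hcd : -(conj a * β) ∈ unitDisk := by simpa [unitDisk, hnorm] using hβ1
  refine ⟨a, -(conj a * β), hnorm, hcd, fun z hz => ?_⟩
  have hz1 : ‖z‖ < 1 := by simpa [unitDisk] using hz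
  have hcd1 : ‖-(conj a * β)‖ < 1 := by simpa [unitDisk] using hcd
  rw [eq_div_iff (one_sub_conj_mul_ne_zero hcd1.le hz1)]
  have h := hbφ z hz
  rw [hφlin z hz] at h
  simp only [map_neg, map_mul, Complex.conj_conj]
  linear_combination h - β * haa
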